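/- For a 3-form ω ∈ Λ³V*: λ(ω) > 0 if and only if ω = α + β for some decomposable real 3-forms α, β with α∧β ≠ 0. Moreover, if λ(ω) > 0 there is exactly one ordered pair (α, β) of decomposable real 3-forms with ω = α + β and α∧β = c·θ for some c > 0, and it is given by 2α = ω + λ(ω)^{−3/2}·K_ω^*(ω) and 2β = ω − λ(ω)^{−3/2}·K_ω^*(ω). -/

import Mathlib

open scoped TensorProduct

/-- The wedge product of alternating forms with values in a commutative algebra `A`
(determinant/shuffle convention, via `AlternatingMap.domCoprod`). -/
noncomputable def wedge {V : Type*} [AddCommGroup V] [Module ℝ V]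
    {A : Type*} [CommRing A] [Algebra ℝ A] {k l : ℕ}
    (α : AlternatingMap ℝ V A (Fin k)) (β : AlternatingMap ℝ V A (Fin l)) :
    AlternatingMap ℝ V A (Fin (k + l)) :=
  (LinearMap.mul' ℝ A).compAlternatingMap ((α.domCoprod β).domDomCongr finSumFinEquiv)

/-- A covector regarded as an alternating `1`-form. -/
noncomputable def oneForm {V : Type*} [AddCommGroup V] [Module ℝ V]
    {A : Type*} [CommRing A] [Algebra ℝ A] (ξ : V →ₗ[ℝ] A) :
    AlternatingMap ℝ V A (Fin 1) :=
  AlternatingMap.ofSubsingleton ℝ V A (0 : Fin 1) ξ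

/-- A real 3-form is decomposable if it is a wedge product of three covectors. -/
def IsDecomposable3 {V : Type*} [AddCommGroup V] [Module ℝ V]
    (α : AlternatingMap ℝ V ℝ (Fin 3)) : Prop :=
  ∃ ξ₁ ξ₂ ξ₃ : Module.Dual ℝ V,
    α = wedge (oneForm ξ₁) (wedge (oneForm ξ₂) (oneForm ξ₃))

section Wedge

variable {V : Type*} [AddCommGroup V] [Module ℝ V]

/-- Splitting a permutation of `Fin (n + 1)` into the image of `0` and the induced permutation of
the remaining entries. -/
theorem sum_sign_perm_fin_succ {W : Type*} {n : ℕ} (F : (Fin (n + 1) → W) → ℝ)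
    (v : Fin (n + 1) → W) :
    ∑ σ : Equiv.Perm (Fin (n + 1)), ((Equiv.Perm.sign σ : ℤ) : ℝ) * F (v ∘ σ) =
      ∑ i : Fin (n + 1), (-1 : ℝ) ^ (i : ℕ) * ∑ τ : Equiv.Perm (Fin n),
        ((Equiv.Perm.sign τ : ℤ) : ℝ) * F (Fin.cons (v i) ((fun j => v (i.succAbove j)) ∘ τ)) := by
  let g : Fin (n + 1) × Equiv.Perm (Fin n) → Equiv.Perm (Fin (n + 1)) :=
    fun p => p.1.cycleRange.symm * Equiv.Perm.decomposeFin.symm (0, p.2)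
  have hg0 : ∀ p, g p 0 = p.1 := fun p => by
    simp [g, Equiv.Perm.mul_apply]
  have hgs : ∀ p j, g p (Fin.succ j) = p.1.succAbove (p.2 j) := fun p j => by
    simp [g, Equiv.Perm.mul_apply]
  have hsign : ∀ p, ((Equiv.Perm.sign (g p) : ℤ) : ℝ) =
      (-1) ^ (p.1 : ℕ) * ((Equiv.Perm.sign p.2 : ℤ) : ℝ) := fun p => by
    simp [g, Equiv.Perm.decomposeFin.symm_sign, Fin.sign_cycleRange]
  have hinj : Function.Injective g := by
    rintro ⟨i, τ⟩ ⟨j, ρ⟩ h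
    have hij : i = j := (hg0 (i, τ)).symm.trans ((congrArg (fun σ => σ 0) h).trans (hg0 (j, ρ)))
    subst hij
    congr 1
    ext k
    have := hgs (i, τ) k
    rw [h, hgs] at this
    exact congrArg _ (Fin.succAbove_right_injective this).symm
  have hbij : Function.Bijective g :=
    (Fintype.bijective_iff_injective_and_card g).2 ⟨hinj, by
      simp [Fintype.card_perm, Nat.factorial_succ]⟩
  simp_rw [Finset.mul_sum]
  rw [← Fintype.sum_prod_type', ← Function.Bijective.sum_comp hbij]
  refine Finset.sum_congr rfl fun p _ => ?_
  have : v ∘ g p = Fin.cons (v p.1) ((fun j => v (p.1.succAbove j)) ∘ p.2) := by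
    funext k
    refine Fin.cases ?_ (fun k => ?_) k
    · simp [hg0]
    · simp [hgs]
  rw [this, hsign, mul_assoc]

theorem factorial_mul_wedge_apply {k l n : ℕ} (h : k + l = n) (α : AlternatingMap ℝ V ℝ (Fin k))
    (β : AlternatingMap ℝ V ℝ (Fin l)) (v : Fin n → V) :
    ((k.factorial * l.factorial : ℕ) : ℝ) * wedge α β (v ∘ Fin.cast h) =
      ∑ σ : Equiv.Perm (Fin n), ((Equiv.Perm.sign σ : ℤ) : ℝ) *
        (α (fun i => (v ∘ σ) (Fin.cast h (Fin.castAdd l i))) *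
          β (fun j => (v ∘ σ) (Fin.cast h (Fin.natAdd k j)))) := by
  subst h
  have h := congrArg (fun f : AlternatingMap ℝ V (ℝ ⊗[ℝ] ℝ) (Fin k ⊕ Fin l) =>
    LinearMap.mul' ℝ ℝ (f (v ∘ finSumFinEquiv))) (MultilinearMap.domCoprod_alternization_eq α β)
  simp only [MultilinearMap.alternatization_apply, Fintype.card_fin, AlternatingMap.smul_apply,
    map_sum, map_nsmul] at h
  rw [nsmul_eq_mul] at h
  change _ = _ * wedge α β v at h
  refine h.symm.trans (Fintype.sum_equiv (Equiv.permCongr finSumFinEquiv) _ _ fun σ => ?_)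
  rw [Units.smul_def, map_zsmul, zsmul_eq_mul]
  simp [Equiv.permCongr_apply, Function.comp_def]

theorem sum_sign_mul_apply_comp {n : ℕ} (α : AlternatingMap ℝ V ℝ (Fin n)) (v : Fin n → V) :
    ∑ σ : Equiv.Perm (Fin n), ((Equiv.Perm.sign σ : ℤ) : ℝ) * α (v ∘ σ) =
      n.factorial * α v := by
  have : ∀ σ : Equiv.Perm (Fin n), ((Equiv.Perm.sign σ : ℤ) : ℝ) * α (v ∘ σ) = α v := fun σ => by
    rw [α.map_perm, Units.smul_def, zsmul_eq_mul, ← mul_assoc, ← Int.cast_mul]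
    simp
  simp [this, Fintype.card_perm]

theorem wedge_oneForm_apply {l : ℕ} (ξ : Module.Dual ℝ V) (β : AlternatingMap ℝ V ℝ (Fin l))
    (v : Fin (l + 1) → V) :
    wedge (oneForm ξ) β (v ∘ Fin.cast (Nat.add_comm 1 l)) =
      ∑ i : Fin (l + 1), (-1 : ℝ) ^ (i : ℕ) * (ξ (v i) * β (fun j => v (i.succAbove j))) := by
  have h := factorial_mul_wedge_apply (Nat.add_comm 1 l) (oneForm ξ) β v
  have h0 : ∀ w : Fin (l + 1) → V,
      oneForm ξ (fun i => w (Fin.cast (Nat.add_comm 1 l) (Fin.castAdd l i))) *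
        β (fun j => w (Fin.cast (Nat.add_comm 1 l) (Fin.natAdd 1 j))) =
      ξ (w 0) * β (fun j => w j.succ) := fun w => by
    refine congrArg (ξ (w 0) * β ·) (funext fun j => congrArg w (Fin.ext ?_))
    simp
  simp only [h0] at h
  rw [sum_sign_perm_fin_succ fun w => ξ (w 0) * β (fun j => w j.succ)] at h
  simp only [Fin.cons_zero, Fin.cons_succ, mul_left_comm _ (ξ _), ← Finset.mul_sum] at h
  have h2 := fun i : Fin (l + 1) => sum_sign_mul_apply_comp β (fun j => v (i.succAbove j))
  simp only [Function.comp_def] at h h2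
  simp only [h2] at h
  have hl : (l.factorial : ℝ) ≠ 0 := Nat.cast_ne_zero.2 l.factorial_ne_zero
  refine mul_left_cancel₀ hl (Eq.trans ?_ (h.trans ?_))
  · simp [Function.comp_def]
  · rw [Finset.mul_sum]
    exact Finset.sum_congr rfl fun i _ => by ring

theorem wedge_two_three_apply (α : AlternatingMap ℝ V ℝ (Fin 2)) (β : AlternatingMap ℝ V ℝ (Fin 3))
    (v : Fin 5 → V) :
    2 * wedge α β v = ∑ i : Fin 5, (-1 : ℝ) ^ (i : ℕ) * ∑ j : Fin 4, (-1 : ℝ) ^ (j : ℕ) *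
      (α ![v i, v (i.succAbove j)] * β (fun k => v (i.succAbove (j.succAbove k)))) := by
  have h := factorial_mul_wedge_apply rfl α β v
  have h0 : ∀ w : Fin 5 → V, α (fun i => w (Fin.cast rfl (Fin.castAdd 3 i))) *
        β (fun j => w (Fin.cast rfl (Fin.natAdd 2 j))) =
      α ![w 0, w 1] * β (fun j => w j.succ.succ) := fun w => by
    congr 2 <;> funext j <;> fin_cases j <;> rfl
  simp only [h0] at h
  rw [sum_sign_perm_fin_succ (n := 4) fun w => α ![w 0, w 1] * β (fun j => w j.succ.succ)] at h
  refine mul_left_cancel₀ (b := 2 * wedge α β v) (show (6 : ℝ) ≠ 0 by norm_num)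
    (Eq.trans ?_ (h.trans ?_))
  · have hv : v ∘ Fin.cast (rfl : 2 + 3 = _) = v := funext fun _ => rfl
    rw [hv, ← mul_assoc]
    norm_num [Nat.factorial]
  · rw [Finset.mul_sum]
    refine Finset.sum_congr rfl fun i _ => ?_
    rw [mul_left_comm]
    congr 1
    refine (sum_sign_perm_fin_succ (n := 3) (fun w => α ![v i, w 0] * β (fun j => w j.succ))
      (fun j => v (i.succAbove j))).trans ?_
    rw [Finset.mul_sum]
    refine Finset.sum_congr rfl fun j _ => ?_
    rw [mul_left_comm]
    congr 1
    simp only [Fin.cons_zero, Fin.cons_succ, mul_left_comm _ (α _), ← Finset.mul_sum]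
    congr 1
    refine (sum_sign_mul_apply_comp β (fun k => v (i.succAbove (j.succAbove k)))).trans ?_
    norm_num [Nat.factorial]

theorem wedge_three_three_apply (α β : AlternatingMap ℝ V ℝ (Fin 3)) (v : Fin 6 → V) :
    6 * wedge α β v = ∑ i : Fin 6, (-1 : ℝ) ^ (i : ℕ) * ∑ j : Fin 5, (-1 : ℝ) ^ (j : ℕ) *
      ∑ k : Fin 4, (-1 : ℝ) ^ (k : ℕ) *
      (α ![v i, v (i.succAbove j), v (i.succAbove (j.succAbove k))] *
        β (fun l => v (i.succAbove (j.succAbove (k.succAbove l))))) := by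
  have h := factorial_mul_wedge_apply rfl α β v
  have h0 : ∀ w : Fin 6 → V, α (fun i => w (Fin.cast rfl (Fin.castAdd 3 i))) *
        β (fun j => w (Fin.cast rfl (Fin.natAdd 3 j))) =
      α ![w 0, w 1, w 2] * β (fun j => w j.succ.succ.succ) := fun w => by
    congr 2 <;> funext j <;> fin_cases j <;> rfl
  simp only [h0] at h
  rw [sum_sign_perm_fin_succ (n := 5) fun w => α ![w 0, w 1, w 2] *
    β (fun j => w j.succ.succ.succ)] at h
  refine mul_left_cancel₀ (b := 6 * wedge α β v) (show (6 : ℝ) ≠ 0 by norm_num)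
    (Eq.trans ?_ (h.trans ?_))
  · have hv : v ∘ Fin.cast (rfl : 3 + 3 = _) = v := funext fun _ => rfl
    rw [hv, ← mul_assoc]
    norm_num [Nat.factorial]
  · rw [Finset.mul_sum]
    refine Finset.sum_congr rfl fun i _ => ?_
    rw [mul_left_comm]
    congr 1
    refine (sum_sign_perm_fin_succ (n := 4) (fun w => α ![v i, w 0, w 1] *
      β (fun j => w j.succ.succ)) (fun j => v (i.succAbove j))).trans ?_
    rw [Finset.mul_sum]
    refine Finset.sum_congr rfl fun j _ => ?_
    rw [mul_left_comm]
    congr 1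
    refine (sum_sign_perm_fin_succ (n := 3) (fun w => α ![v i, v (i.succAbove j), w 0] *
      β (fun j => w j.succ)) (fun k => v (i.succAbove (j.succAbove k)))).trans ?_
    rw [Finset.mul_sum]
    refine Finset.sum_congr rfl fun k _ => ?_
    rw [mul_left_comm]
    congr 1
    simp only [Fin.cons_zero, Fin.cons_succ, mul_left_comm _ (α _), ← Finset.mul_sum]
    congr 1
    refine (sum_sign_mul_apply_comp β
      (fun l => v (i.succAbove (j.succAbove (k.succAbove l))))).trans ?_
    norm_num [Nat.factorial]

end Wedge

section Hitchin

variable {V : Type*} [AddCommGroup V] [Module ℝ V]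

theorem three_form_swap_left (ω : AlternatingMap ℝ V ℝ (Fin 3)) (x y z : V) :
    ω ![x, y, z] = -ω ![y, x, z] := by
  rw [← ω.map_swap ![y, x, z] (show (0 : Fin 3) ≠ 1 by decide)]
  congr 1
  funext i
  fin_cases i <;> rfl

theorem three_form_swap_right (ω : AlternatingMap ℝ V ℝ (Fin 3)) (x y z : V) :
    ω ![x, y, z] = -ω ![x, z, y] := by
  rw [← ω.map_swap ![x, z, y] (show (1 : Fin 3) ≠ 2 by decide)]
  congr 1
  funext i
  fin_cases i <;> rfl

theorem hitchin_coord (θ : AlternatingMap ℝ V ℝ (Fin 6)) (ω : AlternatingMap ℝ V ℝ (Fin 3))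
    (K : V →ₗ[ℝ] V)
    (hK : ∀ (ξ : Module.Dual ℝ V) (X : V),
      ξ (K X) • θ = wedge (oneForm ξ) (wedge (ω.curryLeft X) ω))
    (e : Module.Basis (Fin 6) ℝ V) (p q : Fin 6) :
    2 * (e.repr (K (e q)) p * θ e) = (-1 : ℝ) ^ (p : ℕ) *
      ∑ i : Fin 5, (-1 : ℝ) ^ (i : ℕ) * ∑ j : Fin 4, (-1 : ℝ) ^ (j : ℕ) *
      (ω ![e q, e (p.succAbove i), e (p.succAbove (i.succAbove j))] *
        ω (fun k => e (p.succAbove (i.succAbove (j.succAbove k))))) := by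
  have h := congrArg (fun f => f e) (hK (e.coord p) (e q))
  have h2 := wedge_oneForm_apply (e.coord p) (wedge (ω.curryLeft (e q)) ω) e
  have h3 : e ∘ Fin.cast (Nat.add_comm 1 5) = e := by
    funext i
    rfl
  simp only [h3] at h2
  have h4 := h.trans h2
  simp only [AlternatingMap.smul_apply, smul_eq_mul, Module.Basis.coord_apply,
    Module.Basis.repr_self, Finsupp.single_apply, ite_mul, mul_ite, zero_mul, mul_zero, one_mul,
    Finset.sum_ite_eq', Finset.mem_univ, if_true] at h4
  rw [h4, mul_left_comm, wedge_two_three_apply]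
  rfl

/-- `k` is the matrix of the Hitchin endomorphism of the three-form with coefficients `F`, with
respect to a basis on which the volume form takes the value `t`. -/
structure IsHitchinMatrix (F : Fin 6 → Fin 6 → Fin 6 → ℝ) (k : Fin 6 → Fin 6 → ℝ) (t : ℝ) :
    Prop where
  swap_left : ∀ i j l, F i j l = -F j i l
  swap_right : ∀ i j l, F i j l = -F i l j
  ne_zero : t ≠ 0
  two_mul_mul : ∀ p q, 2 * (k p q * t) = (-1 : ℝ) ^ (p : ℕ) *
      ∑ i : Fin 5, (-1 : ℝ) ^ (i : ℕ) * ∑ j : Fin 4, (-1 : ℝ) ^ (j : ℕ) *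
      (F q (p.succAbove i) (p.succAbove (i.succAbove j)) *
        F (p.succAbove (i.succAbove (j.succAbove 0))) (p.succAbove (i.succAbove (j.succAbove 1)))
          (p.succAbove (i.succAbove (j.succAbove 2))))

namespace IsHitchinMatrix

variable {F : Fin 6 → Fin 6 → Fin 6 → ℝ} {k : Fin 6 → Fin 6 → ℝ} {t : ℝ}

theorem sort_left (h : IsHitchinMatrix F k t) (i j l : Fin 6) (_ : j < i) : F i j l = -F j i l :=
  h.swap_left i j l

theorem sort_right (h : IsHitchinMatrix F k t) (i j l : Fin 6) (_ : l < j) : F i j l = -F i l j :=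
  h.swap_right i j l

theorem self_left (h : IsHitchinMatrix F k t) (i l : Fin 6) : F i i l = 0 := by
  linarith [h.swap_left i i l]

theorem self_right (h : IsHitchinMatrix F k t) (i l : Fin 6) : F i l l = 0 := by
  linarith [h.swap_right i l l]

theorem contraction_eq_zero (h : IsHitchinMatrix F k t) : ∑ m, k m 0 * F m 0 1 = 0 := by
  have hk := h.two_mul_mul
  have h20 := hk 2 0
  have h30 := hk 3 0
  have h40 := hk 4 0
  have h50 := hk 5 0
  simp only [Fin.sum_univ_five, Fin.sum_univ_four] at h20 h30 h40 h50
  simp [Fin.succAbove, Fin.lt_def] at h20 h30 h40 h50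
  simp only [h.sort_right, h.self_left, Fin.reduceLT] at h20 h30 h40 h50
  refine (mul_eq_zero.1 (?_ : (2 * t) * _ = 0)).resolve_left (mul_ne_zero two_ne_zero h.ne_zero)
  simp only [Fin.sum_univ_six, h.sort_left, h.sort_right, h.self_left, h.self_right, Fin.reduceLT]
  linear_combination F 0 1 2 * h20 + F 0 1 3 * h30 + F 0 1 4 * h40 + F 0 1 5 * h50

theorem trace_eq_zero (h : IsHitchinMatrix F k t) : ∑ m, k m m = 0 := by
  have hk := h.two_mul_mul
  have h00 := hk 0 0
  have h11 := hk 1 1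
  have h22 := hk 2 2
  have h33 := hk 3 3
  have h44 := hk 4 4
  have h55 := hk 5 5
  simp only [Fin.sum_univ_five, Fin.sum_univ_four] at h00 h11 h22 h33 h44 h55
  simp [Fin.succAbove, Fin.lt_def] at h00 h11 h22 h33 h44 h55
  simp only [h.sort_left, h.sort_right, Fin.reduceLT] at h00 h11 h22 h33 h44 h55
  refine (mul_eq_zero.1 (?_ : (2 * t) * _ = 0)).resolve_left (mul_ne_zero two_ne_zero h.ne_zero)
  simp only [Fin.sum_univ_six]
  linear_combination h00 + h11 + h22 + h33 + h44 + h55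

theorem sq_one_zero_eq_zero (h : IsHitchinMatrix F k t) : ∑ m, k 1 m * k m 0 = 0 := by
  have hk := h.two_mul_mul
  have h00 := hk 0 0
  have h10 := hk 1 0
  have h20 := hk 2 0
  have h30 := hk 3 0
  have h40 := hk 4 0
  have h50 := hk 5 0
  have h11 := hk 1 1
  have h12 := hk 1 2
  have h13 := hk 1 3
  have h14 := hk 1 4
  have h15 := hk 1 5
  simp only [Fin.sum_univ_five, Fin.sum_univ_four] at h00 h10 h20 h30 h40 h50 h11 h12 h13 h14 h15
  simp [Fin.succAbove, Fin.lt_def] at h00 h10 h20 h30 h40 h50 h11 h12 h13 h14 h15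
  simp only [h.sort_left, h.sort_right, h.self_left, h.self_right, Fin.reduceLT] at h00 h10 h20 h30 h40 h50 h11 h12 h13 h14 h15
  refine (mul_eq_zero.1 (?_ : (2 * t) ^ 2 * _ = 0)).resolve_left
    (pow_ne_zero _ (mul_ne_zero two_ne_zero h.ne_zero))
  have hmul : (2 * t) ^ 2 * ∑ m, k 1 m * k m 0 =
      ∑ m, (2 * (k 1 m * t)) * (2 * (k m 0 * t)) := by
    rw [Finset.mul_sum]
    exact Finset.sum_congr rfl fun m _ => by ring
  rw [hmul, Fin.sum_univ_six, h00, h10, h20, h30, h40, h50, h11, h12, h13, h14, h15]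
  ring

theorem zero_zero_mul (h : IsHitchinMatrix F k t) (hF : ∀ i j l, i < 3 → 3 ≤ l → F i j l = 0) :
    k 0 0 * t = F 0 1 2 * F 3 4 5 := by
  have hk := h.two_mul_mul
  have h00 := hk 0 0
  simp only [Fin.sum_univ_five, Fin.sum_univ_four] at h00
  simp [Fin.succAbove, Fin.lt_def] at h00
  simp only [h.sort_right, Fin.reduceLT] at h00
  simp only [hF, Fin.reduceLT, Fin.reduceLE] at h00
  linarith

end IsHitchinMatrix

theorem oneForm_apply (ξ : Module.Dual ℝ V) (v : Fin 1 → V) : oneForm ξ v = ξ (v 0) := rfl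

theorem wedge_oneForm_three_apply (ξ₁ ξ₂ ξ₃ : Module.Dual ℝ V) (v : Fin 3 → V) :
    wedge (oneForm ξ₁) (wedge (oneForm ξ₂) (oneForm ξ₃)) v =
      ξ₁ (v 0) * (ξ₂ (v 1) * ξ₃ (v 2) - ξ₂ (v 2) * ξ₃ (v 1)) -
      ξ₁ (v 1) * (ξ₂ (v 0) * ξ₃ (v 2) - ξ₂ (v 2) * ξ₃ (v 0)) +
      ξ₁ (v 2) * (ξ₂ (v 0) * ξ₃ (v 1) - ξ₂ (v 1) * ξ₃ (v 0)) := by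
  have h1 := wedge_oneForm_apply ξ₁ (wedge (oneForm ξ₂) (oneForm ξ₃)) v
  have h2 : ∀ w : Fin 2 → V, wedge (oneForm ξ₂) (oneForm ξ₃) w =
      ξ₂ (w 0) * ξ₃ (w 1) - ξ₂ (w 1) * ξ₃ (w 0) := fun w => by
    refine (wedge_oneForm_apply ξ₂ (oneForm ξ₃) w).trans ?_
    simp [Fin.sum_univ_two, oneForm_apply, Fin.succAbove]
    ring
  refine (h1.trans (Finset.sum_congr rfl fun i _ => congrArg (fun r => (-1) ^ (i : ℕ) * (ξ₁ (v i) * r))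
    (h2 fun j => v (i.succAbove j)))).trans ?_
  simp [Fin.sum_univ_three, Fin.succAbove]
  ring

theorem three_form_eta (ω : AlternatingMap ℝ V ℝ (Fin 3)) (v : Fin 3 → V) :
    ω v = ω ![v 0, v 1, v 2] := by
  congr 1
  funext i
  fin_cases i <;> rfl

theorem three_form_sum_left (ω : AlternatingMap ℝ V ℝ (Fin 3)) {ι : Type*} (s : Finset ι)
    (c : ι → ℝ) (f : ι → V) (y z : V) :
    ω ![∑ i ∈ s, c i • f i, y, z] = ∑ i ∈ s, c i * ω ![f i, y, z] := by
  have h : ∀ x, ω.toMultilinearMap.toLinearMap ![0, y, z] 0 x = ω ![x, y, z] := fun x => by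
    rw [MultilinearMap.toLinearMap_apply]
    refine congrArg ω (funext fun i => ?_)
    fin_cases i <;> rfl
  simp [← h]

theorem isHitchinMatrix (θ : AlternatingMap ℝ V ℝ (Fin 6)) (hθ : θ ≠ 0)
    (ω : AlternatingMap ℝ V ℝ (Fin 3)) (K : V →ₗ[ℝ] V)
    (hK : ∀ (ξ : Module.Dual ℝ V) (X : V),
      ξ (K X) • θ = wedge (oneForm ξ) (wedge (ω.curryLeft X) ω))
    (e : Module.Basis (Fin 6) ℝ V) :
    IsHitchinMatrix (fun i j l => ω ![e i, e j, e l]) (fun p q => e.repr (K (e q)) p) (θ e) where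
  swap_left _ _ _ := three_form_swap_left _ _ _ _
  swap_right _ _ _ := three_form_swap_right _ _ _ _
  ne_zero := (AlternatingMap.map_basis_ne_zero_iff e θ).2 hθ
  two_mul_mul p q := by
    rw [hitchin_coord θ ω K hK e p q]
    refine congrArg _ (Finset.sum_congr rfl fun i _ => congrArg _ (Finset.sum_congr rfl fun j _ =>
      congrArg _ (congrArg _ ?_)))
    exact three_form_eta ω _

end Hitchin

section LinearAlgebra

variable {V : Type*} [AddCommGroup V] [Module ℝ V] [FiniteDimensional ℝ V]

theorem LinearIndependent.exists_basis_extending {k l : ℕ} {v : Fin k → V}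
    (hv : LinearIndependent ℝ v) (hdim : Module.finrank ℝ V = k + l) :
    ∃ e : Module.Basis (Fin (k + l)) ℝ V, ∀ i, e (Fin.castAdd l i) = v i := by
  let b := Module.Basis.sumExtend hv
  have : Finite (Fin k ⊕ Module.Basis.sumExtendIndex hv) := Module.Finite.finite_basis b
  have : Finite (Module.Basis.sumExtendIndex hv) := Finite.sum_right (Fin k)
  have := Fintype.ofFinite (Module.Basis.sumExtendIndex hv)
  have hcard : Fintype.card (Module.Basis.sumExtendIndex hv) = l := by
    have h := Module.finrank_eq_card_basis b
    rw [hdim, Fintype.card_sum, Fintype.card_fin] at h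
    omega
  refine ⟨b.reindex (((Equiv.refl (Fin k)).sumCongr (Fintype.equivFinOfCardEq hcard)).trans
    finSumFinEquiv), fun i => ?_⟩
  simp [b, Module.Basis.sumExtend]
  rfl

/-- An endomorphism with square `s ^ 2`, `s ≠ 0`, and trace zero on a six-dimensional space has an
eigenbasis with three eigenvalues `s` and three eigenvalues `-s`. -/
theorem LinearMap.exists_eigenbasis_of_sq_of_trace_eq_zero (hdim : Module.finrank ℝ V = 6)
    (K : V →ₗ[ℝ] V) {s : ℝ} (hs : s ≠ 0) (hK : ∀ x, K (K x) = (s * s) • x)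
    (htr : LinearMap.trace ℝ V K = 0) :
    ∃ e : Module.Basis (Fin 6) ℝ V, (∀ i, i < 3 → K (e i) = s • e i) ∧
      ∀ i, 3 ≤ i → K (e i) = (-s) • e i := by
  have key : ∀ r : ℝ, r * r = s * s → ∃ p : Submodule ℝ V, Module.finrank ℝ p = 3 ∧
      (∀ x, x ∈ p ↔ K x = r • x) := fun r hr => by
    have hr0 : r ≠ 0 := fun h => hs (by simpa [h] using hr.symm)
    refine ⟨LinearMap.ker (K - r • LinearMap.id), ?_, fun x => by simp [sub_eq_zero]⟩
    have hproj : LinearMap.IsProj (LinearMap.ker (K - r • LinearMap.id))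
        ((2⁻¹ : ℝ) • (LinearMap.id + r⁻¹ • K)) := by
      constructor
      · intro x
        have : r⁻¹ * (r * r) = r := by field_simp
        simp only [LinearMap.mem_ker, LinearMap.sub_apply, LinearMap.smul_apply,
          LinearMap.add_apply, LinearMap.id_apply, map_smul, map_add, hK, ← hr]
        rw [smul_sub r⁻¹, smul_smul r⁻¹, smul_smul r⁻¹, this, inv_mul_cancel₀ hr0]
        module
      · intro x hx
        have hx : K x = r • x := by simpa [sub_eq_zero] using hx
        simp only [LinearMap.smul_apply, LinearMap.add_apply, LinearMap.id_apply, hx, smul_smul,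
          inv_mul_cancel₀ hr0]
        module
    have h := hproj.trace
    simp only [map_smul, map_add, htr, LinearMap.trace_id, hdim, smul_eq_mul] at h
    exact_mod_cast (show (Module.finrank ℝ (LinearMap.ker (K - r • LinearMap.id)) : ℝ) = 3 by
      rw [← h]; norm_num)
  obtain ⟨p, hp, hpK⟩ := key s rfl
  obtain ⟨q, hq, hqK⟩ := key (-s) (by ring)
  have hdisj : Disjoint p q := by
    rw [Submodule.disjoint_def]
    intro x hx hx'
    rw [hpK] at hx
    rw [hqK, hx] at hx'
    have : (2 * s) • x = 0 := by
      rw [two_mul, add_smul]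
      nth_rewrite 1 [hx']
      simp
    exact (smul_eq_zero.1 this).resolve_left (mul_ne_zero two_ne_zero hs)
  have hcompl : IsCompl p q := by
    refine ⟨hdisj, codisjoint_iff.2 (Submodule.eq_top_of_finrank_eq ?_)⟩
    have h := Submodule.finrank_sup_add_finrank_inf_eq p q
    rw [hdisj.eq_bot, finrank_bot] at h
    omega
  let b := ((Module.finBasisOfFinrankEq ℝ p hp).prod (Module.finBasisOfFinrankEq ℝ q hq)).map
    (Submodule.prodEquivOfIsCompl p q hcompl)
  have hb1 : ∀ i : Fin 3, b.reindex finSumFinEquiv (Fin.castAdd 3 i) ∈ p := fun i => by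
    rw [Module.Basis.reindex_apply, finSumFinEquiv_symm_apply_castAdd]
    simp [b]
  have hb2 : ∀ i : Fin 3, b.reindex finSumFinEquiv (Fin.natAdd 3 i) ∈ q := fun i => by
    rw [Module.Basis.reindex_apply, finSumFinEquiv_symm_apply_natAdd]
    simp [b]
  refine ⟨b.reindex finSumFinEquiv, fun i hi => (hpK _).1 ?_, fun i hi => (hqK _).1 ?_⟩
  · exact hb1 ⟨i, hi⟩
  · have h := hb2 ⟨i - 3, by omega⟩
    convert h
    ext
    simp
    omega

end LinearAlgebra

section Hitchin

variable {V : Type*} [AddCommGroup V] [Module ℝ V] [FiniteDimensional ℝ V]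

theorem three_form_add_left {V : Type*} [AddCommGroup V] [Module ℝ V]
    (ω : AlternatingMap ℝ V ℝ (Fin 3)) (x x' y z : V) :
    ω ![x + x', y, z] = ω ![x, y, z] + ω ![x', y, z] := by
  have h (w : V) : ![w, y, z] = Function.update ![x, y, z] 0 w := by
    funext i
    fin_cases i <;> rfl
  rw [h (x + x'), ω.map_update_add, ← h, ← h]

theorem hitchin_apply_self (hdim : Module.finrank ℝ V = 6)
    {θ : AlternatingMap ℝ V ℝ (Fin 6)} (hθ : θ ≠ 0)
    {ω : AlternatingMap ℝ V ℝ (Fin 3)} {K : V →ₗ[ℝ] V}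
    (hK : ∀ (ξ : Module.Dual ℝ V) (X : V),
      ξ (K X) • θ = wedge (oneForm ξ) (wedge (ω.curryLeft X) ω)) (x z : V) :
    ω ![K x, x, z] = 0 := by
  have hzero : ∀ y, ω ![K x, y, y] = 0 := fun y =>
    ω.map_eq_zero_of_eq _ (i := 1) (j := 2) rfl (by decide)
  by_cases hx : x = 0
  · exact ω.map_coord_zero 1 hx
  by_cases hli : LinearIndependent ℝ ![x, z]
  · obtain ⟨e, he⟩ := hli.exists_basis_extending (l := 4) hdim
    have he0 : e 0 = x := he 0
    have he1 : e 1 = z := he 1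
    have h := (isHitchinMatrix θ hθ ω K hK e).contraction_eq_zero
    rw [← three_form_sum_left, e.sum_repr, he0, he1] at h
    exact h
  · rw [LinearIndependent.pair_iff' hx] at hli
    push Not at hli
    obtain ⟨a, rfl⟩ := hli
    have h := three_form_sum_left ω {()} (fun _ => a) (fun _ => x) (K x) x
    simp only [Finset.sum_singleton] at h
    rw [three_form_swap_right, three_form_swap_left, neg_neg, h, three_form_swap_left, hzero,
      neg_zero, mul_zero]

theorem hitchin_apply_comm (hdim : Module.finrank ℝ V = 6)
    {θ : AlternatingMap ℝ V ℝ (Fin 6)} (hθ : θ ≠ 0)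
    {ω : AlternatingMap ℝ V ℝ (Fin 3)} {K : V →ₗ[ℝ] V}
    (hK : ∀ (ξ : Module.Dual ℝ V) (X : V),
      ξ (K X) • θ = wedge (oneForm ξ) (wedge (ω.curryLeft X) ω)) (x y z : V) :
    ω ![K x, y, z] = ω ![x, K y, z] := by
  have h := hitchin_apply_self hdim hθ hK (x + y) z
  have hx := hitchin_apply_self hdim hθ hK x z
  have hy := hitchin_apply_self hdim hθ hK y z
  rw [map_add, three_form_add_left, three_form_swap_left _ _ (x + y),
    three_form_swap_left _ _ (x + y), three_form_add_left, three_form_add_left,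
    three_form_swap_left _ x (K x), hx, three_form_swap_left _ y (K y), hy,
    three_form_swap_left _ y (K x)] at h
  linarith

theorem hitchin_sq (hdim : Module.finrank ℝ V = 6)
    {θ : AlternatingMap ℝ V ℝ (Fin 6)} (hθ : θ ≠ 0)
    {ω : AlternatingMap ℝ V ℝ (Fin 3)} {K : V →ₗ[ℝ] V}
    (hK : ∀ (ξ : Module.Dual ℝ V) (X : V),
      ξ (K X) • θ = wedge (oneForm ξ) (wedge (ω.curryLeft X) ω)) :
    K ∘ₗ K = ((1 / 6 : ℝ) * LinearMap.trace ℝ V (K ∘ₗ K)) • LinearMap.id := by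
  obtain ⟨a, ha⟩ := LinearMap.exists_eq_smul_id_of_forall_notLinearIndependent (f := K ∘ₗ K)
    fun v hv => by
      obtain ⟨e, he⟩ := hv.exists_basis_extending (l := 4) hdim
      have he0 : e 0 = v := he 0
      have he1 : e 1 = K (K v) := he 1
      have h := (isHitchinMatrix θ hθ ω K hK e).sq_one_zero_eq_zero
      have h1 : e.repr (K (K v)) 1 = 1 := by rw [← he1]; simp
      have h2 : K v = ∑ m, e.repr (K (e 0)) m • e m := by rw [e.sum_repr, he0]
      rw [h2] at h1
      simp only [map_sum, map_smul, Finsupp.coe_finsetSum, Finset.sum_apply, Finsupp.smul_apply,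
        smul_eq_mul] at h1
      simp_rw [mul_comm (e.repr (K (e 0)) _)] at h1
      rw [h] at h1
      exact zero_ne_one h1
  change _ = a • LinearMap.id at ha
  rw [ha]
  congr 1
  simp [hdim]
  ring

theorem hitchin_trace (hdim : Module.finrank ℝ V = 6)
    {θ : AlternatingMap ℝ V ℝ (Fin 6)} (hθ : θ ≠ 0)
    {ω : AlternatingMap ℝ V ℝ (Fin 3)} {K : V →ₗ[ℝ] V}
    (hK : ∀ (ξ : Module.Dual ℝ V) (X : V),
      ξ (K X) • θ = wedge (oneForm ξ) (wedge (ω.curryLeft X) ω)) :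
    LinearMap.trace ℝ V K = 0 := by
  let e := Module.finBasisOfFinrankEq ℝ V hdim
  rw [LinearMap.trace_eq_matrix_trace ℝ e K]
  simp only [Matrix.trace, Matrix.diag, LinearMap.toMatrix_apply]
  exact (isHitchinMatrix θ hθ ω K hK e).trace_eq_zero

end Hitchin

section Decomposition

variable {V : Type*} [AddCommGroup V] [Module ℝ V]

/-- The value of the product of the `a`-th, `b`-th and `c`-th covectors of a dual basis on the
`i`-th, `j`-th and `l`-th basis vectors. -/
def dualTriple (a b c i j l : Fin 6) : ℤ :=
  (if i = a then 1 else 0) * ((if j = b then 1 else 0) * (if l = c then 1 else 0) -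
    (if l = b then 1 else 0) * (if j = c then 1 else 0)) -
  (if j = a then 1 else 0) * ((if i = b then 1 else 0) * (if l = c then 1 else 0) -
    (if l = b then 1 else 0) * (if i = c then 1 else 0)) +
  (if l = a then 1 else 0) * ((if i = b then 1 else 0) * (if j = c then 1 else 0) -
    (if j = b then 1 else 0) * (if i = c then 1 else 0))

theorem wedge_coord_apply (e : Module.Basis (Fin 6) ℝ V) (a b c i j l : Fin 6) :
    wedge (oneForm (e.coord a)) (wedge (oneForm (e.coord b)) (oneForm (e.coord c)))
      ![e i, e j, e l] = dualTriple a b c i j l := by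
  rw [wedge_oneForm_three_apply]
  simp only [dualTriple, Module.Basis.coord_apply, Matrix.cons_val_zero, Matrix.cons_val_one, Matrix.cons_val,
    Module.Basis.repr_self, Finsupp.single_apply]
  push_cast
  rfl

theorem hitchin_matrix_dualTriple (p q : Fin 6) : (-1 : ℤ) ^ (p : ℕ) *
      ∑ i : Fin 5, (-1 : ℤ) ^ (i : ℕ) * ∑ j : Fin 4, (-1 : ℤ) ^ (j : ℕ) *
      ((dualTriple 0 1 2 q (p.succAbove i) (p.succAbove (i.succAbove j)) +
          dualTriple 3 4 5 q (p.succAbove i) (p.succAbove (i.succAbove j))) *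
        (dualTriple 0 1 2 (p.succAbove (i.succAbove (j.succAbove 0)))
            (p.succAbove (i.succAbove (j.succAbove 1)))
            (p.succAbove (i.succAbove (j.succAbove 2))) +
          dualTriple 3 4 5 (p.succAbove (i.succAbove (j.succAbove 0)))
            (p.succAbove (i.succAbove (j.succAbove 1)))
            (p.succAbove (i.succAbove (j.succAbove 2))))) =
    if p = q then (if p < 3 then 2 else -2) else 0 := by
  revert p q
  decide +kernel

theorem wedge_dualTriple :
    ∑ i : Fin 6, (-1 : ℤ) ^ (i : ℕ) * ∑ j : Fin 5, (-1 : ℤ) ^ (j : ℕ) *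
      ∑ k : Fin 4, (-1 : ℤ) ^ (k : ℕ) *
      (dualTriple 0 1 2 i (i.succAbove j) (i.succAbove (j.succAbove k)) *
        dualTriple 3 4 5 (i.succAbove (j.succAbove (k.succAbove 0)))
          (i.succAbove (j.succAbove (k.succAbove 1)))
          (i.succAbove (j.succAbove (k.succAbove 2)))) = 6 := by
  decide +kernel

theorem three_form_smul_left (ω : AlternatingMap ℝ V ℝ (Fin 3)) (a : ℝ) (x y z : V) :
    ω ![a • x, y, z] = a * ω ![x, y, z] := by
  simpa using three_form_sum_left ω {()} (fun _ => a) (fun _ => x) y z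

theorem AlternatingMap.eq_of_forall_basis_three {α β : AlternatingMap ℝ V ℝ (Fin 3)}
    (e : Module.Basis (Fin 6) ℝ V) (h : ∀ i j l, α ![e i, e j, e l] = β ![e i, e j, e l]) :
    α = β :=
  e.ext_alternating fun v _ => by
    rw [three_form_eta α, three_form_eta β]
    exact h _ _ _

/-- The covectors of two decomposable three-forms with nonzero product form a dual basis. -/
theorem exists_basis_coord_of_wedge_ne_zero [FiniteDimensional ℝ V]
    (hdim : Module.finrank ℝ V = 6) (ξ : Fin 6 → Module.Dual ℝ V)
    (h : wedge (wedge (oneForm (ξ 0)) (wedge (oneForm (ξ 1)) (oneForm (ξ 2))))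
      (wedge (oneForm (ξ 3)) (wedge (oneForm (ξ 4)) (oneForm (ξ 5)))) ≠ 0) :
    ∃ e : Module.Basis (Fin 6) ℝ V, ∀ i, e.coord i = ξ i := by
  have hinj : Function.Injective (LinearMap.pi ξ) := by
    rw [← LinearMap.ker_eq_bot, Submodule.eq_bot_iff]
    intro x hx
    by_contra hx0
    have hξ (i) : ξ i x = 0 := congrFun (LinearMap.mem_ker.1 hx) i
    have hli : LinearIndependent ℝ ![x] := by
      rw [linearIndependent_unique_iff]
      exact hx0
    obtain ⟨e, he⟩ := hli.exists_basis_extending (l := 5) hdim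
    have he0 : e 0 = x := he 0
    refine h ((AlternatingMap.map_basis_eq_zero_iff e _).1 ?_)
    refine (mul_eq_zero.1 ?_ : (6 : ℝ) = 0 ∨ _).resolve_left (by norm_num)
    rw [wedge_three_three_apply]
    refine Finset.sum_eq_zero fun i _ => mul_eq_zero_of_right _ <|
      Finset.sum_eq_zero fun j _ => mul_eq_zero_of_right _ <|
      Finset.sum_eq_zero fun k _ => mul_eq_zero_of_right _ ?_
    rw [wedge_oneForm_three_apply, wedge_oneForm_three_apply]
    by_cases hi : i = 0
    · simp [hi, he0, hξ]
    by_cases hj : j = 0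
    · simp [hj, hi, Fin.succAbove_ne_zero_zero, he0, hξ]
    by_cases hk : k = 0
    · simp [hk, hj, hi, Fin.succAbove_ne_zero_zero, he0, hξ]
    · simp [hk, hj, hi, Fin.succAbove_ne_zero_zero, he0, hξ]
  let L := (LinearMap.pi ξ).linearEquivOfInjective hinj (by simp [hdim])
  refine ⟨Module.Basis.ofEquivFun L, fun i => ?_⟩
  ext x
  simp [L]

theorem hitchin_apply_basis {θ : AlternatingMap ℝ V ℝ (Fin 6)} (hθ : θ ≠ 0)
    {ω : AlternatingMap ℝ V ℝ (Fin 3)} {K : V →ₗ[ℝ] V}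
    (hK : ∀ (ξ : Module.Dual ℝ V) (X : V),
      ξ (K X) • θ = wedge (oneForm ξ) (wedge (ω.curryLeft X) ω))
    (e : Module.Basis (Fin 6) ℝ V)
    (he : ∀ i j l, ω ![e i, e j, e l] = (dualTriple 0 1 2 i j l + dualTriple 3 4 5 i j l : ℤ))
    (q : Fin 6) : K (e q) = (((if q < 3 then 1 else -1 : ℤ) : ℝ) * (θ e)⁻¹) • e q := by
  have h := isHitchinMatrix θ hθ ω K hK e
  refine e.repr.injective (Finsupp.ext fun p => ?_)
  have h2 := h.two_mul_mul p q
  have h3 := congrArg (Int.cast : ℤ → ℝ) (hitchin_matrix_dualTriple p q)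
  simp only [he] at h2
  rw [map_smul, Finsupp.smul_apply, Module.Basis.repr_self, Finsupp.single_apply]
  push_cast at h2 h3
  rw [h3] at h2
  have ht := h.ne_zero
  refine mul_right_cancel₀ ht ?_
  by_cases hpq : p = q
  · subst hpq
    by_cases hp : p < 3
    · simp only [hp, if_true, Int.cast_one, smul_eq_mul, mul_one, one_mul,
        inv_mul_cancel₀ ht] at h2 ⊢
      linarith
    · simp only [hp, if_true, if_false, Int.cast_one, Int.cast_neg, smul_eq_mul, mul_one, one_mul,
        neg_mul, inv_mul_cancel₀ ht] at h2 ⊢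
      linarith
  · simpa [hpq, Ne.symm hpq, ht] using h2

theorem hitchin_pfaffian_eq [FiniteDimensional ℝ V] (hdim : Module.finrank ℝ V = 6)
    {K : V →ₗ[ℝ] V} {r : ℝ} (e : Module.Basis (Fin 6) ℝ V)
    (hKe : ∀ q, K (e q) = (((if q < 3 then 1 else -1 : ℤ) : ℝ) * r) • e q) :
    (1 / 6 : ℝ) * LinearMap.trace ℝ V (K ∘ₗ K) = r ^ 2 := by
  have h : K ∘ₗ K = (r ^ 2) • LinearMap.id := e.ext fun q => by
    rw [LinearMap.comp_apply, hKe, map_smul, hKe, smul_smul, LinearMap.smul_apply,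
      LinearMap.id_apply]
    congr 1
    split_ifs
    · push_cast
      ring
    · push_cast
      ring
  rw [h, map_smul, LinearMap.trace_id, hdim, smul_eq_mul]
  push_cast
  ring

theorem sign_mul_dualTriple (i j l : Fin 6) :
    ((if i < 3 then 1 else -1) * (if j < 3 then 1 else -1) * (if l < 3 then 1 else -1)) *
      (dualTriple 0 1 2 i j l + dualTriple 3 4 5 i j l) =
    dualTriple 0 1 2 i j l - dualTriple 3 4 5 i j l := by
  revert i j l
  decide +kernel

theorem compLinearMap_eq_smul_sub {K : V →ₗ[ℝ] V} {r : ℝ} (e : Module.Basis (Fin 6) ℝ V)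
    (hKe : ∀ q, K (e q) = (((if q < 3 then 1 else -1 : ℤ) : ℝ) * r) • e q)
    {α β : AlternatingMap ℝ V ℝ (Fin 3)} (hα : ∀ i j l, α ![e i, e j, e l] = dualTriple 0 1 2 i j l)
    (hβ : ∀ i j l, β ![e i, e j, e l] = dualTriple 3 4 5 i j l) :
    (α + β).compLinearMap K = r ^ 3 • (α - β) := by
  refine e.ext_alternating fun v _ => ?_
  rw [AlternatingMap.compLinearMap_apply]
  simp only [hKe]
  rw [AlternatingMap.map_smul_univ, three_form_eta (α + β), AlternatingMap.smul_apply,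
    three_form_eta (α - β)]
  simp only [AlternatingMap.add_apply, AlternatingMap.sub_apply, hα, hβ, Fin.prod_univ_three,
    smul_eq_mul]
  have h := congrArg (Int.cast : ℤ → ℝ) (sign_mul_dualTriple (v 0) (v 1) (v 2))
  push_cast at h ⊢
  rw [← h]
  ring

theorem wedge_apply_basis_eq_one (e : Module.Basis (Fin 6) ℝ V)
    {α β : AlternatingMap ℝ V ℝ (Fin 3)} (hα : ∀ i j l, α ![e i, e j, e l] = dualTriple 0 1 2 i j l)
    (hβ : ∀ i j l, β ![e i, e j, e l] = dualTriple 3 4 5 i j l) :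
    wedge α β e = 1 := by
  have hβ' (v : Fin 3 → Fin 6) :
      β (fun l => e (v l)) = dualTriple 3 4 5 (v 0) (v 1) (v 2) := by
    rw [three_form_eta β]
    exact hβ _ _ _
  refine mul_left_cancel₀ (by norm_num : (6 : ℝ) ≠ 0) ?_
  have h := congrArg (Int.cast : ℤ → ℝ) wedge_dualTriple
  push_cast at h
  rw [wedge_three_three_apply, mul_one, ← h]
  simp only [hα, hβ']

theorem IsHitchinMatrix.eq_dualTriple {F : Fin 6 → Fin 6 → Fin 6 → ℝ} {k : Fin 6 → Fin 6 → ℝ}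
    {t : ℝ} (h : IsHitchinMatrix F k t) (hF : ∀ i j l, i < 3 → 3 ≤ l → F i j l = 0)
    (i j l : Fin 6) :
    F i j l = F 0 1 2 * dualTriple 0 1 2 i j l + F 3 4 5 * dualTriple 3 4 5 i j l := by
  fin_cases i <;> fin_cases j <;> fin_cases l <;>
    simp only [Fin.zero_eta, Fin.mk_one, Fin.reduceFinMk, Fin.isValue] <;>
    simp [dualTriple, h.sort_left, h.sort_right, h.self_left, h.self_right, hF]

theorem hitchin_eigen_apply_eq_zero [FiniteDimensional ℝ V] (hdim : Module.finrank ℝ V = 6)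
    {θ : AlternatingMap ℝ V ℝ (Fin 6)} (hθ : θ ≠ 0)
    {ω : AlternatingMap ℝ V ℝ (Fin 3)} {K : V →ₗ[ℝ] V}
    (hK : ∀ (ξ : Module.Dual ℝ V) (X : V),
      ξ (K X) • θ = wedge (oneForm ξ) (wedge (ω.curryLeft X) ω))
    {s : ℝ} (hs : s ≠ 0) {x z : V} (hx : K x = s • x) (hz : K z = (-s) • z) (y : V) :
    ω ![x, y, z] = 0 := by
  have h := hitchin_apply_comm hdim hθ hK x z y
  rw [hx, hz, three_form_smul_left, three_form_swap_left _ x (_ • _), three_form_smul_left,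
    three_form_swap_left _ z, three_form_swap_right _ x z] at h
  refine (mul_eq_zero.1 (?_ : s * _ = 0)).resolve_left hs
  linarith

/-- A three-form whose Hitchin endomorphism has square `s ^ 2 ≠ 0` takes the normal form
`e⁰ ∧ e¹ ∧ e² + e³ ∧ e⁴ ∧ e⁵` in some basis. -/
theorem exists_basis_normal_form [FiniteDimensional ℝ V] (hdim : Module.finrank ℝ V = 6)
    {θ : AlternatingMap ℝ V ℝ (Fin 6)} (hθ : θ ≠ 0)
    {ω : AlternatingMap ℝ V ℝ (Fin 3)} {K : V →ₗ[ℝ] V}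
    (hK : ∀ (ξ : Module.Dual ℝ V) (X : V),
      ξ (K X) • θ = wedge (oneForm ξ) (wedge (ω.curryLeft X) ω))
    {s : ℝ} (hs : s ≠ 0) (hsq : ∀ x, K (K x) = (s * s) • x) :
    ∃ e : Module.Basis (Fin 6) ℝ V, s * θ e = 1 ∧
      ∀ i j l, ω ![e i, e j, e l] = (dualTriple 0 1 2 i j l + dualTriple 3 4 5 i j l : ℤ) := by
  obtain ⟨b, hb1, hb2⟩ := LinearMap.exists_eigenbasis_of_sq_of_trace_eq_zero hdim K hs hsq
    (hitchin_trace hdim hθ hK)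
  have hzero {i j l : Fin 6} (hi : i < 3) (hl : 3 ≤ l) : ω ![b i, b j, b l] = 0 :=
    hitchin_eigen_apply_eq_zero hdim hθ hK hs (hb1 i hi) (hb2 l hl) _
  have hmul := (isHitchinMatrix θ hθ ω K hK b).zero_zero_mul fun i j l => hzero
  simp only [hb1 0 (by decide), map_smul, Finsupp.smul_apply, Module.Basis.repr_self,
    Finsupp.single_eq_same, smul_eq_mul, mul_one] at hmul
  have hprod := hmul ▸ mul_ne_zero hs (isHitchinMatrix θ hθ ω K hK b).ne_zero
  have ha := left_ne_zero_of_mul hprod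
  have hb := right_ne_zero_of_mul hprod
  set a := ω ![b 0, b 1, b 2]
  set c := ω ![b 3, b 4, b 5]
  let w : Fin 6 → ℝ := ![a⁻¹, 1, 1, c⁻¹, 1, 1]
  have hw (i) : IsUnit (w i) := by
    fin_cases i <;> simp [w, ha, hb]
  let e := b.isUnitSMul hw
  have he (i) : e i = w i • b i := b.isUnitSMul_apply hw i
  have hmap {i : Fin 6} {r : ℝ} (h : K (b i) = r • b i) : K (e i) = r • e i := by
    rw [he, map_smul, h, smul_comm]
  have h := isHitchinMatrix θ hθ ω K hK e
  have hF (i j l : Fin 6) (hi : i < 3) (hl : 3 ≤ l) : ω ![e i, e j, e l] = 0 :=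
    hitchin_eigen_apply_eq_zero hdim hθ hK hs (hmap (hb1 i hi)) (hmap (hb2 l hl)) _
  have h012 : ω ![e 0, e 1, e 2] = 1 := by
    simp only [he, w, three_form_smul_left]
    simp [a, ha]
  have h345 : ω ![e 3, e 4, e 5] = 1 := by
    simp only [he, w, three_form_smul_left]
    simp [c, hb]
  refine ⟨e, ?_, fun i j l => ?_⟩
  · have h0 := h.zero_zero_mul hF
    simpa [hmap (hb1 0 (by decide)), h012, h345] using h0
  · rw [h.eq_dualTriple hF i j l, h012, h345]
    push_cast
    ring

/-- A decomposition of a three-form into decomposable forms with nonzero product, in coordinates. -/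
theorem exists_basis_of_isDecomposable3 [FiniteDimensional ℝ V] (hdim : Module.finrank ℝ V = 6)
    {α β : AlternatingMap ℝ V ℝ (Fin 3)} (hα : IsDecomposable3 α) (hβ : IsDecomposable3 β)
    (h : wedge α β ≠ 0) :
    ∃ e : Module.Basis (Fin 6) ℝ V, (∀ i j l, α ![e i, e j, e l] = dualTriple 0 1 2 i j l) ∧
      ∀ i j l, β ![e i, e j, e l] = dualTriple 3 4 5 i j l := by
  obtain ⟨ξ₀, ξ₁, ξ₂, rfl⟩ := hα
  obtain ⟨ξ₃, ξ₄, ξ₅, rfl⟩ := hβ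
  obtain ⟨e, he⟩ := exists_basis_coord_of_wedge_ne_zero hdim ![ξ₀, ξ₁, ξ₂, ξ₃, ξ₄, ξ₅] h
  refine ⟨e, fun i j l => ?_, fun i j l => ?_⟩
  · rw [← wedge_coord_apply e, he, he, he]
    rfl
  · rw [← wedge_coord_apply e, he, he, he]
    rfl

theorem hitchin_decomposition_formula [FiniteDimensional ℝ V] (hdim : Module.finrank ℝ V = 6)
    {θ : AlternatingMap ℝ V ℝ (Fin 6)} (hθ : θ ≠ 0)
    {ω : AlternatingMap ℝ V ℝ (Fin 3)} {K : V →ₗ[ℝ] V}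
    (hK : ∀ (ξ : Module.Dual ℝ V) (X : V),
      ξ (K X) • θ = wedge (oneForm ξ) (wedge (ω.curryLeft X) ω))
    {lam : ℝ} (hlam : lam = (1 / 6 : ℝ) * LinearMap.trace ℝ V (K ∘ₗ K))
    {α β : AlternatingMap ℝ V ℝ (Fin 3)} (hα : IsDecomposable3 α) (hβ : IsDecomposable3 β)
    (hω : ω = α + β) {c : ℝ} (hc : 0 < c) (hwedge : wedge α β = c • θ) :
    (2 : ℝ) • α = ω + lam ^ (-(3 / 2) : ℝ) • ω.compLinearMap K ∧
      (2 : ℝ) • β = ω - lam ^ (-(3 / 2) : ℝ) • ω.compLinearMap K := by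
  obtain ⟨e, heα, heβ⟩ := exists_basis_of_isDecomposable3 hdim hα hβ
    (hwedge ▸ smul_ne_zero hc.ne' hθ)
  have hKe := hitchin_apply_basis hθ hK e fun i j l => by
    rw [hω, AlternatingMap.add_apply, heα, heβ, Int.cast_add]
  have hθe : c * θ e = 1 := by
    rw [← wedge_apply_basis_eq_one e heα heβ, hwedge]
    rfl
  rw [← eq_inv_of_mul_eq_one_left hθe] at hKe
  have hpow : lam ^ (-(3 / 2) : ℝ) = (c ^ 3)⁻¹ := by
    rw [hlam, hitchin_pfaffian_eq hdim e hKe, ← Real.rpow_natCast, ← Real.rpow_mul hc.le,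
      ← Real.rpow_natCast, ← Real.rpow_neg hc.le]
    norm_num
  rw [hpow, hω, compLinearMap_eq_smul_sub e hKe heα heβ, inv_smul_smul₀ (pow_ne_zero 3 hc.ne')]
  constructor <;> module

theorem exists_hitchin_decomposition [FiniteDimensional ℝ V] (hdim : Module.finrank ℝ V = 6)
    {θ : AlternatingMap ℝ V ℝ (Fin 6)} (hθ : θ ≠ 0)
    {ω : AlternatingMap ℝ V ℝ (Fin 3)} {K : V →ₗ[ℝ] V}
    (hK : ∀ (ξ : Module.Dual ℝ V) (X : V),
      ξ (K X) • θ = wedge (oneForm ξ) (wedge (ω.curryLeft X) ω))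
    (hpos : 0 < (1 / 6 : ℝ) * LinearMap.trace ℝ V (K ∘ₗ K)) :
    ∃ α β : AlternatingMap ℝ V ℝ (Fin 3), IsDecomposable3 α ∧ IsDecomposable3 β ∧ ω = α + β ∧
      ∃ c : ℝ, 0 < c ∧ wedge α β = c • θ := by
  have hs := Real.sqrt_pos.2 hpos
  obtain ⟨e, hθe, he⟩ := exists_basis_normal_form hdim hθ hK hs.ne' fun x => by
    rw [Real.mul_self_sqrt hpos.le]
    exact LinearMap.congr_fun (hitchin_sq hdim hθ hK) x
  refine ⟨_, _, ⟨e.coord 0, e.coord 1, e.coord 2, rfl⟩, ⟨e.coord 3, e.coord 4, e.coord 5, rfl⟩,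
    AlternatingMap.eq_of_forall_basis_three e fun i j l => ?_, _, hs, ?_⟩
  · rw [he, AlternatingMap.add_apply, wedge_coord_apply, wedge_coord_apply, Int.cast_add]
  · refine (AlternatingMap.eq_smul_basis_det e _).trans ?_
    rw [wedge_apply_basis_eq_one e (wedge_coord_apply e 0 1 2) (wedge_coord_apply e 3 4 5),
      AlternatingMap.eq_smul_basis_det e θ, smul_smul, hθe]

end Decomposition

/-- Hitchin: `λ(ω) > 0` iff `ω` is a sum of two decomposable real 3-forms `α, β` with
`α∧β ≠ 0`; in that case there is exactly one such ordered pair with `α∧β` a positive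
multiple of the volume form `θ`, and it is given by `2α = ω + λ(ω)^{-3/2}·K_ω^*(ω)`,
`2β = ω − λ(ω)^{-3/2}·K_ω^*(ω)`. -/
theorem hitchin_positive_pfaffian_decomposition
    {V : Type*} [AddCommGroup V] [Module ℝ V] [FiniteDimensional ℝ V]
    (hdim : Module.finrank ℝ V = 6)
    (θ : AlternatingMap ℝ V ℝ (Fin 6)) (hθ : θ ≠ 0)
    (ω : AlternatingMap ℝ V ℝ (Fin 3))
    (K : V →ₗ[ℝ] V)
    (hK : ∀ (ξ : Module.Dual ℝ V) (X : V),
      ξ (K X) • θ = wedge (oneForm ξ) (wedge (ω.curryLeft X) ω))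
    (lam : ℝ) (hlam : lam = (1 / 6 : ℝ) * LinearMap.trace ℝ V (K ∘ₗ K)) :
    (0 < lam ↔ ∃ α β : AlternatingMap ℝ V ℝ (Fin 3),
        IsDecomposable3 α ∧ IsDecomposable3 β ∧ wedge α β ≠ 0 ∧ ω = α + β) ∧
    (0 < lam →
      (∃! p : AlternatingMap ℝ V ℝ (Fin 3) × AlternatingMap ℝ V ℝ (Fin 3),
        IsDecomposable3 p.1 ∧ IsDecomposable3 p.2 ∧ ω = p.1 + p.2 ∧
          ∃ c : ℝ, 0 < c ∧ wedge p.1 p.2 = c • θ) ∧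
      (∀ p : AlternatingMap ℝ V ℝ (Fin 3) × AlternatingMap ℝ V ℝ (Fin 3),
        (IsDecomposable3 p.1 ∧ IsDecomposable3 p.2 ∧ ω = p.1 + p.2 ∧
          ∃ c : ℝ, 0 < c ∧ wedge p.1 p.2 = c • θ) →
        (2 : ℝ) • p.1 = ω + lam ^ (-(3 / 2) : ℝ) • ω.compLinearMap K ∧
        (2 : ℝ) • p.2 = ω - lam ^ (-(3 / 2) : ℝ) • ω.compLinearMap K)) := by
  have hformula := fun p : AlternatingMap ℝ V ℝ (Fin 3) × AlternatingMap ℝ V ℝ (Fin 3) =>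
    fun h : IsDecomposable3 p.1 ∧ IsDecomposable3 p.2 ∧ ω = p.1 + p.2 ∧
      ∃ c : ℝ, 0 < c ∧ wedge p.1 p.2 = c • θ =>
    hitchin_decomposition_formula hdim hθ hK hlam h.1 h.2.1 h.2.2.1
      h.2.2.2.choose_spec.1 h.2.2.2.choose_spec.2
  refine ⟨⟨fun hpos => ?_, ?_⟩, fun hpos => ⟨?_, hformula⟩⟩
  · obtain ⟨α, β, hα, hβ, hω, c, hc, hwedge⟩ :=
      exists_hitchin_decomposition hdim hθ hK (hlam ▸ hpos)
    exact ⟨α, β, hα, hβ, hwedge ▸ smul_ne_zero hc.ne' hθ, hω⟩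
  · rintro ⟨α, β, hα, hβ, hwedge, hω⟩
    obtain ⟨e, heα, heβ⟩ := exists_basis_of_isDecomposable3 hdim hα hβ hwedge
    have hKe := hitchin_apply_basis hθ hK e fun i j l => by
      rw [hω, AlternatingMap.add_apply, heα, heβ, Int.cast_add]
    rw [hlam, hitchin_pfaffian_eq hdim e hKe]
    exact sq_pos_of_ne_zero (inv_ne_zero (isHitchinMatrix θ hθ ω K hK e).ne_zero)
  · obtain ⟨α, β, h⟩ := exists_hitchin_decomposition hdim hθ hK (hlam ▸ hpos)
    refine ⟨(α, β), h, fun p hp => Prod.ext ?_ ?_⟩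
    · exact smul_right_injective _ (two_ne_zero' ℝ)
        ((hformula p hp).1.trans (hformula (α, β) h).1.symm)
    · exact smul_right_injective _ (two_ne_zero' ℝ)
        ((hformula p hp).2.trans (hformula (α, β) h).2.symm)
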